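/- Under conditions (C), (E1) and (E2), there exist β₂ ∈ ℝ, σ₂ ≥ 0 with 2σ₂ + ωγ₀ ≥ ω²γ₀, and a σ-finite measure ν on (0, ∞) with ∫₀^∞ (u ∧ u²) ν(du) < ∞ such that the pointwise limit H of {H_n} satisfies H(λ) = β₂λ − σ₂λ² − ∫₀^∞ (e^{−λu} − 1 + λu) ν(du) for all λ ≥ 0, and moreover as n → ∞: (i) n ∫₀^∞ (χ(u) − u) ν_n(du) → β₂ − ∫₀^∞ (u − χ(u)) ν(du); (ii) n ∫₀^∞ χ²(u) ν_n(du) → 2σ₂ + ωγ₀ + ∫₀^∞ χ²(u) ν(du); (iii) n ∫₀^∞ f(u) ν_n(du) → ∫₀^∞ f(u) ν(du) for every bounded continuous f : [0, ∞) → ℝ with f(x) = o(x²) as x → 0. -/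

import Mathlib

open MeasureTheory Filter Topology

/-- The probability generating function of an `ℕ`-valued distribution `q`. -/
noncomputable def pgf (q : ℕ → ℝ) (s : ℝ) : ℝ := ∑' i, q i * s ^ i

/-- The mean `h'(1) = ∑ i * q i` of an `ℕ`-valued distribution `q`. -/
noncomputable def pgfMean (q : ℕ → ℝ) : ℝ := ∑' i : ℕ, (i : ℝ) * q i

/-- `H_n(λ) = n [(1 − ω_n λ/c_n) − h_n(1 − λ/c_n)]`. -/
noncomputable def Hseq (q : ℕ → ℕ → ℝ) (c : ℕ → ℝ) (n : ℕ) (l : ℝ) : ℝ :=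
  (n : ℝ) * ((1 - pgfMean (q n) * l / c n) - pgf (q n) (1 - l / c n))

/-- `χ(x) = (1 ∧ x) ∨ (−1)`. -/
noncomputable def chi (x : ℝ) : ℝ := max (min 1 x) (-1)

/-- `ν_n = ∑ᵢ q_n(i) δ_{i/c_n}`, the law of `η/c_n` for `η` with distribution `q_n`. -/
noncomputable def lawDiv (q : ℕ → ℝ) (c : ℝ) : Measure ℝ :=
  Measure.sum fun i : ℕ => ENNReal.ofReal (q i) • Measure.dirac ((i : ℝ) / c)

section

open scoped NNReal BoundedContinuousFunction

/-- The function `u ↦ exp (-u)` on `ℝ≥0`, as a bounded continuous function. -/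
noncomputable def expNegBCF : ℝ≥0 →ᵇ ℝ :=
  BoundedContinuousFunction.ofNormedAddCommGroup (fun u : ℝ≥0 => Real.exp (-(u : ℝ)))
    (by fun_prop) 1 (fun u => by
      rw [Real.norm_eq_abs, Real.abs_exp]
      exact Real.exp_le_one_iff.2 (by simp))

lemma expNegBCF_pow_apply (k : ℕ) (u : ℝ≥0) :
    (expNegBCF ^ k) u = Real.exp (-(k : ℝ) * u) := by
  have : expNegBCF u = Real.exp (-(u : ℝ)) := rfl
  rw [BoundedContinuousFunction.pow_apply, this, ← Real.exp_nat_mul]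
  congr 1; ring

/-- A finite measure on `ℝ≥0` is determined by its Laplace transform at the integers. -/
lemma finiteMeasure_ext_of_laplace {P P' : FiniteMeasure ℝ≥0}
    (h : ∀ k : ℕ, ∫ u : ℝ≥0, Real.exp (-(k : ℝ) * u) ∂(P : Measure ℝ≥0) =
      ∫ u : ℝ≥0, Real.exp (-(k : ℝ) * u) ∂(P' : Measure ℝ≥0)) : P = P' := by
  let A : StarSubalgebra ℝ (ℝ≥0 →ᵇ ℝ) :=
    { Algebra.adjoin ℝ {expNegBCF} with
      star_mem' := fun {a} ha => by
        have : star a = a := by ext; simp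
        rwa [this] }
  have hA : (A.map (BoundedContinuousFunction.toContinuousMapStarₐ ℝ)).SeparatesPoints := by
    intro x y hxy
    refine ⟨expNegBCF, ⟨BoundedContinuousFunction.toContinuousMapStarₐ ℝ expNegBCF,
      ⟨expNegBCF, Algebra.subset_adjoin rfl, rfl⟩, rfl⟩, ?_⟩
    intro hh
    have : Real.exp (-(x : ℝ)) = Real.exp (-(y : ℝ)) := hh
    rw [Real.exp_eq_exp, neg_inj] at this
    exact hxy (NNReal.coe_injective this)
  apply Subtype.ext
  refine ext_of_forall_mem_subalgebra_integral_eq_of_polish (P := (P : Measure ℝ≥0))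
    (P' := (P' : Measure ℝ≥0)) hA ?_
  intro g hg
  have hg' : g ∈ Algebra.adjoin ℝ {expNegBCF} := hg
  rw [Algebra.adjoin_singleton_eq_range_aeval] at hg'
  obtain ⟨p, rfl⟩ := hg'
  induction p using Polynomial.induction_on' with
  | add p q hp hq =>
    simp only [map_add, BoundedContinuousFunction.coe_add, Pi.add_apply]
    rw [integral_add (BoundedContinuousFunction.integrable _ _)
      (BoundedContinuousFunction.integrable _ _),
      integral_add (BoundedContinuousFunction.integrable _ _)
      (BoundedContinuousFunction.integrable _ _)]
    have mem (r : Polynomial ℝ) : (Polynomial.aeval expNegBCF) r ∈ A := by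
      change _ ∈ Algebra.adjoin ℝ {expNegBCF}
      rw [Algebra.adjoin_singleton_eq_range_aeval]
      exact ⟨r, rfl⟩
    exact congrArg₂ (· + ·) (hp (mem p)) (hq (mem q))
  | monomial k a =>
    have (u : ℝ≥0) : ((Polynomial.aeval expNegBCF) ((Polynomial.monomial k) a)) u
        = a * Real.exp (-(k : ℝ) * u) := by
      rw [Polynomial.aeval_monomial, ← Algebra.smul_def, BoundedContinuousFunction.smul_apply,
        expNegBCF_pow_apply, smul_eq_mul]
    have key (R : FiniteMeasure ℝ≥0) :
        ∫ u, ((Polynomial.aeval expNegBCF) ((Polynomial.monomial k) a)) u ∂(R : Measure ℝ≥0)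
          = a * ∫ u : ℝ≥0, Real.exp (-(k : ℝ) * u) ∂(R : Measure ℝ≥0) := by
      simp only [this, integral_const_mul]
    exact (key P).trans ((congrArg (a * ·) (h k)).trans (key P').symm)

/-- A tight sequence of finite measures on `ℝ≥0` whose Laplace transforms converge at the integers
converges weakly. -/
lemma exists_tendsto_of_laplace_tendsto (P : ℕ → FiniteMeasure ℝ≥0) (C : ℝ≥0) (u : ℕ → ℝ≥0)
    (K : ℕ → Set ℝ≥0) (hu : Tendsto u atTop (𝓝 0)) (hK : ∀ j, IsCompact (K j))
    (hC : ∀ n, (P n).mass ≤ C) (hPK : ∀ n j, P n (K j)ᶜ ≤ u j)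
    (h : ∀ k : ℕ, ∃ l, Tendsto (fun n => ∫ u : ℝ≥0, Real.exp (-(k : ℝ) * u) ∂(P n : Measure ℝ≥0))
      atTop (𝓝 l)) :
    ∃ Q : FiniteMeasure ℝ≥0, Tendsto P atTop (𝓝 Q) := by
  have hS := isCompact_setOfPred_finiteMeasure_mass_le_compl_isCompact_le (E := ℝ≥0) C hu hK
    (Or.inl inferInstance)
  have lim (U : Ultrafilter ℕ) (hU : (U : Filter ℕ) ≤ atTop) :
      ∃ Q : FiniteMeasure ℝ≥0, Tendsto P U (𝓝 Q) := by
    obtain ⟨Q, -, hQ⟩ := hS.ultrafilter_le_nhds (U.map P) (by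
      rw [Ultrafilter.coe_map, le_principal_iff, mem_map]
      exact univ_mem' fun n => ⟨hC n, hPK n⟩)
    exact ⟨Q, hQ⟩
  have lap (U : Ultrafilter ℕ) (Q : FiniteMeasure ℝ≥0) (hQ : Tendsto P U (𝓝 Q)) (k : ℕ) :
      Tendsto (fun n => ∫ u : ℝ≥0, Real.exp (-(k : ℝ) * u) ∂(P n : Measure ℝ≥0)) U
        (𝓝 (∫ u : ℝ≥0, Real.exp (-(k : ℝ) * u) ∂(Q : Measure ℝ≥0))) := by
    have := (FiniteMeasure.tendsto_iff_forall_integral_tendsto.1 hQ) (expNegBCF ^ k)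
    simpa only [expNegBCF_pow_apply] using this
  obtain ⟨Q, hQ⟩ := lim (hyperfilter ℕ) Nat.hyperfilter_le_atTop
  refine ⟨Q, (tendsto_iff_ultrafilter _ _ _).2 fun U hU => ?_⟩
  obtain ⟨Q', hQ'⟩ := lim U hU
  suffices Q' = Q by rwa [this] at hQ'
  refine finiteMeasure_ext_of_laplace fun k => ?_
  obtain ⟨l, hl⟩ := h k
  rw [tendsto_nhds_unique (lap U Q' hQ' k) (hl.mono_left hU),
    tendsto_nhds_unique (lap _ Q hQ k) (hl.mono_left Nat.hyperfilter_le_atTop)]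

/-- The compensated exponential `u ↦ exp (-l u) - 1 + l u`. -/
noncomputable def compExp (l u : ℝ) : ℝ := Real.exp (-l * u) - 1 + l * u

/-- The weight `u ↦ (1 - exp (-u)) ^ 2`. -/
noncomputable def expWeight (u : ℝ) : ℝ := (1 - Real.exp (-u)) ^ 2

lemma continuous_compExp (l : ℝ) : Continuous (compExp l) := by unfold compExp; fun_prop

lemma continuous_expWeight : Continuous expWeight := by unfold expWeight; fun_prop

lemma compExp_nonneg (l u : ℝ) : 0 ≤ compExp l u := by
  have := Real.add_one_le_exp (-l * u)
  unfold compExp; linarith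

lemma compExp_eq_one (l u : ℝ) : compExp l u = compExp 1 (l * u) := by
  simp only [compExp]; ring_nf

lemma expWeight_nonneg (u : ℝ) : 0 ≤ expWeight u := sq_nonneg _

lemma expWeight_le_one {u : ℝ} (hu : 0 ≤ u) : expWeight u ≤ 1 := by
  have h1 := Real.exp_pos (-u)
  have h2 : Real.exp (-u) ≤ 1 := Real.exp_le_one_iff.2 (by linarith)
  unfold expWeight; nlinarith

lemma expWeight_pos {u : ℝ} (hu : 0 < u) : 0 < expWeight u := by
  have h2 : Real.exp (-u) < 1 := Real.exp_lt_one_iff.2 (by linarith)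
  exact pow_pos (by linarith) 2

lemma expWeight_mono {u v : ℝ} (hu : 0 ≤ u) (huv : u ≤ v) : expWeight u ≤ expWeight v := by
  have h1 : Real.exp (-u) ≤ 1 := Real.exp_le_one_iff.2 (by linarith)
  have h2 : Real.exp (-v) ≤ Real.exp (-u) := Real.exp_le_exp.2 (by linarith)
  exact pow_le_pow_left₀ (by linarith) (by linarith) 2

lemma exp_mul_expWeight (l u : ℝ) : Real.exp (-l * u) * expWeight u =
    compExp l u - 2 * compExp (l + 1) u + compExp (l + 2) u := by
  have h1 : Real.exp (-(l + 1) * u) = Real.exp (-l * u) * Real.exp (-u) := by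
    rw [← Real.exp_add]; ring_nf
  have h2 : Real.exp (-(l + 2) * u) = Real.exp (-l * u) * (Real.exp (-u) * Real.exp (-u)) := by
    rw [← Real.exp_add, ← Real.exp_add]; ring_nf
  simp only [compExp, expWeight, h1, h2]; ring

lemma integrable_compExp {m : Measure ℝ} [IsFiniteMeasure m] (h0 : ∀ᵐ u ∂m, 0 ≤ u)
    (hInt : Integrable (fun u => u) m) {l : ℝ} (hl : 0 ≤ l) : Integrable (compExp l) m := by
  refine Integrable.add (Integrable.sub ?_ (integrable_const _)) (hInt.const_mul l)
  refine Integrable.of_bound (by fun_prop) 1 ?_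
  filter_upwards [h0] with u hu
  rw [Real.norm_eq_abs, Real.abs_exp]
  exact Real.exp_le_one_iff.2 (by nlinarith)

lemma integrable_expWeight {m : Measure ℝ} [IsFiniteMeasure m] (h0 : ∀ᵐ u ∂m, 0 ≤ u) :
    Integrable expWeight m := by
  refine Integrable.of_bound continuous_expWeight.aestronglyMeasurable 1 ?_
  filter_upwards [h0] with u hu
  rw [Real.norm_eq_abs, abs_of_nonneg (expWeight_nonneg u)]
  exact expWeight_le_one hu

/-- The measure with density `expWeight`, transported to `ℝ≥0`. -/
noncomputable def weightedNN (m : Measure ℝ) : Measure ℝ≥0 :=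
  (m.withDensity (fun u => ENNReal.ofReal (expWeight u))).map Real.toNNReal

lemma measurable_ofReal_expWeight : Measurable (fun u => ENNReal.ofReal (expWeight u)) :=
  continuous_expWeight.measurable.ennreal_ofReal

lemma isFiniteMeasure_weightedNN {m : Measure ℝ} [IsFiniteMeasure m] (h0 : ∀ᵐ u ∂m, 0 ≤ u) :
    IsFiniteMeasure (weightedNN m) := by
  have := isFiniteMeasure_withDensity_ofReal (integrable_expWeight h0).2
  unfold weightedNN; infer_instance

lemma integral_weightedNN {m : Measure ℝ} {φ : ℝ≥0 → ℝ} (hφ : Continuous φ) :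
    ∫ u, φ u ∂(weightedNN m) = ∫ u, φ u.toNNReal * expWeight u ∂m := by
  unfold weightedNN
  rw [integral_map (by fun_prop) hφ.aestronglyMeasurable,
    integral_withDensity_eq_integral_toReal_smul measurable_ofReal_expWeight (by simp)]
  refine integral_congr_ae (Eventually.of_forall fun u => ?_)
  simp [ENNReal.toReal_ofReal (expWeight_nonneg u), mul_comm]

lemma weightedNN_tail_le {m : Measure ℝ} [IsFiniteMeasure m] (h0 : ∀ᵐ u ∂m, 0 ≤ u)
    (hInt : Integrable (fun u => u) m) (j : ℕ) :
    weightedNN m (Set.Icc 0 ((j : ℝ≥0) + 2))ᶜ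
      ≤ ENNReal.ofReal ((∫ u, compExp 1 u ∂m) / (j + 1)) := by
  unfold weightedNN
  rw [Measure.map_apply (by fun_prop) measurableSet_Icc.compl,
    withDensity_apply _ (measurableSet_Icc.compl.preimage (by fun_prop))]
  set S := Real.toNNReal ⁻¹' (Set.Icc 0 ((j : ℝ≥0) + 2))ᶜ
  calc ∫⁻ u in S, ENNReal.ofReal (expWeight u) ∂m ≤ ∫⁻ u in S, 1 ∂m := by
        refine lintegral_mono_ae (ae_restrict_of_ae ?_)
        filter_upwards [h0] with u hu
        exact ENNReal.ofReal_le_one.2 (expWeight_le_one hu)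
    _ = m S := by simp
    _ ≤ m {u | (j : ℝ) + 1 ≤ compExp 1 u} := by
        refine measure_mono fun u hu => ?_
        have h : (j : ℝ≥0) + 2 < u.toNNReal := by simpa [S] using hu
        have h2 : (j : ℝ) + 2 < u := by
          rw [Real.lt_toNNReal_iff_coe_lt] at h
          exact_mod_cast h
        have := Real.exp_pos (-1 * u)
        simp only [compExp, Set.mem_ofPred_eq]; linarith
    _ ≤ ENNReal.ofReal ((∫ u, compExp 1 u ∂m) / (j + 1)) := by
        have := mul_meas_ge_le_integral_of_nonneg
          (Eventually.of_forall (compExp_nonneg 1)) (integrable_compExp h0 hInt zero_le_one)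
          ((j : ℝ) + 1)
        rw [← ofReal_measureReal]
        refine ENNReal.ofReal_le_ofReal ?_
        rw [le_div_iff₀ (by positivity), mul_comm]
        exact this

/-- If the integrals of all compensated exponentials converge, the measures weighted by `expWeight`
converge weakly. -/
lemma exists_weighted_limit {m : ℕ → Measure ℝ} [∀ n, IsFiniteMeasure (m n)]
    (h0 : ∀ n, ∀ᵐ u ∂m n, 0 ≤ u) (hInt : ∀ n, Integrable (fun u => u) (m n)) {L : ℝ → ℝ}
    (hL : ∀ l, 0 ≤ l → Tendsto (fun n => ∫ u, compExp l u ∂m n) atTop (𝓝 (L l))) :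
    ∃ μ : Measure ℝ, IsFiniteMeasure μ ∧ μ (Set.Iio 0) = 0 ∧
      ∀ φ : ℝ → ℝ, Continuous φ → (∃ C, ∀ u, |φ u| ≤ C) →
        Tendsto (fun n => ∫ u, φ u * expWeight u ∂m n) atTop (𝓝 (∫ u, φ u ∂μ)) := by
  let P (n : ℕ) : FiniteMeasure ℝ≥0 := ⟨weightedNN (m n), isFiniteMeasure_weightedNN (h0 n)⟩
  have hP (n : ℕ) : (P n : Measure ℝ≥0) = weightedNN (m n) := rfl
  have hlap (k : ℕ) : Tendsto
      (fun n => ∫ u : ℝ≥0, Real.exp (-(k : ℝ) * u) ∂(P n : Measure ℝ≥0)) atTop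
      (𝓝 (L k - 2 * L (k + 1) + L (k + 2))) := by
    have hk : (0 : ℝ) ≤ k := k.cast_nonneg
    refine (((hL k hk).sub ((hL (k + 1) (by linarith)).const_mul 2)).add
      (hL (k + 2) (by linarith))).congr fun n => ?_
    rw [hP, integral_weightedNN (by fun_prop)]
    have i0 := integrable_compExp (h0 n) (hInt n) hk
    have i1 := integrable_compExp (h0 n) (hInt n) (l := k + 1) (by linarith)
    have i2 := integrable_compExp (h0 n) (hInt n) (l := k + 2) (by linarith)
    have e1 := integral_sub i0 (i1.const_mul 2)
    have e2 := integral_add (f := fun u => compExp k u - 2 * compExp (k + 1) u)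
      (i0.sub (i1.const_mul 2)) i2
    rw [← integral_const_mul, ← e1, ← e2]
    refine integral_congr_ae ?_
    filter_upwards [h0 n] with u hu
    rw [Real.coe_toNNReal u hu, exp_mul_expWeight]
  obtain ⟨C, hC⟩ := (hlap 0).bddAbove_range
  obtain ⟨D, hD⟩ := (hL 1 zero_le_one).bddAbove_range
  obtain ⟨Q, hQ⟩ := exists_tendsto_of_laplace_tendsto P C.toNNReal
    (fun j => (D / (j + 1)).toNNReal) (fun j => Set.Icc 0 ((j : ℝ≥0) + 2))
    (by
      have : Tendsto (fun j : ℕ => D / ((j : ℝ) + 1)) atTop (𝓝 0) :=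
        tendsto_const_div_atTop_nhds_zero_nat D |>.comp (tendsto_add_atTop_nat 1) |>.congr
          (fun j => by simp)
      simpa [Function.comp_def] using (continuous_real_toNNReal.tendsto 0).comp this)
    (fun j => isCompact_Icc)
    (fun n => by
      have : ((P n).mass : ℝ) ≤ C := by
        have := hC ⟨n, rfl⟩
        simp only [Nat.cast_zero, neg_zero, zero_mul, Real.exp_zero, integral_const, smul_eq_mul,
          mul_one] at this
        exact this
      exact NNReal.le_toNNReal_of_coe_le this)
    (fun n j => by
      have h1 := weightedNN_tail_le (h0 n) (hInt n) j
      have h2 : (∫ u, compExp 1 u ∂m n) ≤ D := hD ⟨n, rfl⟩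
      rw [← ENNReal.coe_le_coe, FiniteMeasure.ennreal_coeFn_eq_coeFn_toMeasure, hP]
      refine h1.trans (ENNReal.ofReal_le_ofReal ?_)
      gcongr)
    (fun k => ⟨_, hlap k⟩)
  refine ⟨(Q : Measure ℝ≥0).map (fun u : ℝ≥0 => (u : ℝ)), inferInstance, ?_, ?_⟩
  · rw [Measure.map_apply (by fun_prop) measurableSet_Iio]
    convert measure_empty (μ := (Q : Measure ℝ≥0))
    ext u; simp
  · rintro φ hφ ⟨C', hC'⟩
    let ψ : ℝ≥0 →ᵇ ℝ := BoundedContinuousFunction.ofNormedAddCommGroup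
      (fun u : ℝ≥0 => φ u) (by fun_prop) C' (fun u => hC' u)
    have := FiniteMeasure.tendsto_iff_forall_integral_tendsto.1 hQ ψ
    rw [integral_map (by fun_prop) hφ.aestronglyMeasurable]
    refine this.congr fun n => ?_
    rw [hP, integral_weightedNN ψ.continuous]
    refine integral_congr_ae ?_
    filter_upwards [h0 n] with u hu
    simp [ψ, Real.coe_toNNReal u hu]

lemma abs_compExp_one_sub_le {x : ℝ} (h0 : 0 ≤ x) (h1 : x ≤ 1) :
    |compExp 1 x - x ^ 2 / 2| ≤ x ^ 3 := by
  have := Real.exp_bound (x := -x) (by rw [abs_neg, abs_of_nonneg h0]; exact h1) (n := 3)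
    (by norm_num)
  simp only [Finset.sum_range_succ, Finset.sum_range_zero, abs_neg, abs_of_nonneg h0] at this
  norm_num [Nat.factorial] at this
  have h3 : 0 ≤ x ^ 3 := by positivity
  have e : compExp 1 x - x ^ 2 / 2 = Real.exp (-x) - (1 + -x + x ^ 2 / 2) := by
    simp only [compExp, neg_mul, one_mul]; ring
  rw [e]
  exact this.trans (by linarith)

lemma compExp_one_le_sq {x : ℝ} (h0 : 0 ≤ x) : compExp 1 x ≤ x ^ 2 := by
  have h1 : Real.exp (-x) ≤ 1 / (1 + x) := by
    rw [Real.exp_neg, ← one_div]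
    exact one_div_le_one_div_of_le (by linarith) (by linarith [Real.add_one_le_exp x])
  have h2 : 1 / (1 + x) ≤ 1 - x + x ^ 2 := by
    rw [div_le_iff₀ (by linarith)]
    nlinarith [pow_nonneg h0 3]
  simp only [compExp, neg_mul, one_mul]; linarith

lemma compExp_le_mul {l u : ℝ} (h : 0 ≤ l * u) : compExp l u ≤ l * u := by
  have : Real.exp (-l * u) ≤ 1 := Real.exp_le_one_iff.2 (by linarith)
  unfold compExp; linarith

lemma min_le_compExp (u : ℝ) : min u (u ^ 2) ≤ 4 * compExp 1 u := by
  rcases le_total u 2 with h | h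
  · refine (min_le_right _ _).trans ?_
    have h1 : 1 - u / 2 ≤ Real.exp (-u / 2) := by linarith [Real.add_one_le_exp (-u / 2)]
    have h2 : Real.exp (-1 * u) = Real.exp (-u / 2) ^ 2 := by
      rw [← Real.exp_nat_mul]; congr 1; push_cast; ring
    have := pow_le_pow_left₀ (by linarith) h1 2
    simp only [compExp, h2]; nlinarith
  · refine (min_le_left _ _).trans ?_
    have := Real.exp_pos (-1 * u)
    simp only [compExp]; linarith

lemma tendsto_compExp_div_sq {l : ℝ} (hl : 0 ≤ l) :
    Tendsto (fun u => compExp l u / u ^ 2) (𝓝[>] 0) (𝓝 (l ^ 2 / 2)) := by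
  rw [tendsto_iff_norm_sub_tendsto_zero]
  have lim : Tendsto (fun u : ℝ => l ^ 3 * u) (𝓝[>] 0) (𝓝 0) := by
    have : Tendsto (fun u : ℝ => l ^ 3 * u) (𝓝 0) (𝓝 (l ^ 3 * 0)) :=
      (continuous_const.mul continuous_id).tendsto 0
    rw [mul_zero] at this
    exact this.mono_left nhdsWithin_le_nhds
  refine squeeze_zero' (Eventually.of_forall fun _ => norm_nonneg _) ?_ lim
  have h1 : ∀ᶠ u : ℝ in 𝓝[>] 0, l * u < 1 := by
    have : Tendsto (fun u : ℝ => l * u) (𝓝 0) (𝓝 (l * 0)) :=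
      (continuous_const.mul continuous_id).tendsto 0
    rw [mul_zero] at this
    exact (this.eventually_lt_const zero_lt_one).filter_mono nhdsWithin_le_nhds
  filter_upwards [h1, self_mem_nhdsWithin] with u hu hu0
  have hu0 : 0 < u := hu0
  have := abs_compExp_one_sub_le (mul_nonneg hl hu0.le) hu.le
  rw [← compExp_eq_one] at this
  have e : compExp l u / u ^ 2 - l ^ 2 / 2 = (compExp l u - (l * u) ^ 2 / 2) / u ^ 2 := by
    field_simp
  rw [e, norm_div, Real.norm_eq_abs, Real.norm_eq_abs, abs_of_nonneg (sq_nonneg u),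
    div_le_iff₀ (by positivity)]
  exact this.trans (le_of_eq (by ring))

lemma tendsto_expWeight_div_sq : Tendsto (fun u => expWeight u / u ^ 2) (𝓝[>] 0) (𝓝 1) := by
  have h := ((tendsto_compExp_div_sq (l := 0) le_rfl).sub
    ((tendsto_compExp_div_sq (l := 1) zero_le_one).const_mul 2)).add
    (tendsto_compExp_div_sq (l := 2) zero_le_two)
  convert h using 2 with u
  · have := exp_mul_expWeight 0 u
    simp only [neg_zero, zero_mul, Real.exp_zero, one_mul, zero_add] at this
    rw [this]; ring
  · norm_num

/-- The measure with density `1 / expWeight` with respect to the restriction of `μ` to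
`(0, ∞)`. -/
noncomputable def unweighted (μ : Measure ℝ) : Measure ℝ :=
  (μ.restrict (Set.Ioi 0)).withDensity (fun u => ENNReal.ofReal (expWeight u)⁻¹)

lemma measurable_ofReal_inv_expWeight :
    Measurable (fun u => ENNReal.ofReal (expWeight u)⁻¹) :=
  continuous_expWeight.measurable.inv.ennreal_ofReal

lemma unweighted_Iic (μ : Measure ℝ) : unweighted μ (Set.Iic 0) = 0 := by
  refine withDensity_absolutelyContinuous _ _ ?_
  rw [Measure.restrict_apply measurableSet_Iic]
  convert measure_empty (μ := μ)
  ext u; simp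

lemma unweighted_restrict (μ : Measure ℝ) :
    (unweighted μ).restrict (Set.Ioi 0) = unweighted μ := by
  refine Measure.restrict_eq_self_of_ae_mem ?_
  rw [ae_iff]
  convert unweighted_Iic μ using 2
  ext u; simp

lemma sigmaFinite_unweighted (μ : Measure ℝ) [IsFiniteMeasure μ] :
    SigmaFinite (unweighted μ) := by
  unfold unweighted
  exact SigmaFinite.withDensity_ofReal _

/-- The quotient `g / expWeight`, extended by `κ` to `(-∞, 0]`. -/
noncomputable def quotExt (g : ℝ → ℝ) (κ : ℝ) (u : ℝ) : ℝ :=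
  if u ≤ 0 then κ else g u / expWeight u

lemma tendsto_quotExt_nhdsGT {g : ℝ → ℝ} {κ : ℝ}
    (hκ : Tendsto (fun u => g u / u ^ 2) (𝓝[>] 0) (𝓝 κ)) :
     Tendsto (quotExt g κ) (𝓝[>] 0) (𝓝 κ) := by
  have := hκ.div tendsto_expWeight_div_sq one_ne_zero
  rw [div_one] at this
  refine this.congr' ?_
  filter_upwards [self_mem_nhdsWithin] with u hu
  have hu : 0 < u := hu
  simp only [quotExt, not_le.2 hu, if_false, Pi.div_apply]
  field_simp

lemma continuous_quotExt {g : ℝ → ℝ} {κ : ℝ} (hg : ContinuousOn g (Set.Ici 0))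
    (hκ : Tendsto (fun u => g u / u ^ 2) (𝓝[>] 0) (𝓝 κ)) :
     Continuous (quotExt g κ) := by
  rw [continuous_iff_continuousAt]
  intro x
  rcases lt_trichotomy x 0 with hx | rfl | hx
  · refine continuousAt_const (y := κ) |>.congr ?_
    filter_upwards [Iio_mem_nhds hx] with u hu
    exact (if_pos (le_of_lt hu)).symm
  · rw [continuousAt_iff_continuous_left'_right']
    have h0 : quotExt g κ 0 = κ := if_pos le_rfl
    constructor
    · refine (continuousWithinAt_const (b := κ)).congr_of_eventuallyEq ?_ h0
      filter_upwards [self_mem_nhdsWithin] with u hu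
      exact if_pos (le_of_lt hu)
    · rw [ContinuousWithinAt, h0]
      exact tendsto_quotExt_nhdsGT hκ
  · have h1 : ContinuousAt (fun u => g u / expWeight u) x :=
      (hg.continuousAt (Ici_mem_nhds hx)).div continuous_expWeight.continuousAt
        (expWeight_pos hx).ne'
    refine h1.congr ?_
    filter_upwards [Ioi_mem_nhds hx] with u hu
    exact (if_neg (not_le.2 hu)).symm

lemma bounded_quotExt {g : ℝ → ℝ} {κ : ℝ}
    (hκ : Tendsto (fun u => g u / u ^ 2) (𝓝[>] 0) (𝓝 κ))
    (hb : ∃ C, ∀ u, 0 ≤ u → |g u| ≤ C) : ∃ C, ∀ u, |quotExt g κ u| ≤ C := by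
  obtain ⟨C, hC⟩ := hb
  have h1 : ∀ᶠ u in 𝓝[>] 0, |quotExt g κ u| < |κ| + 1 :=
    (tendsto_quotExt_nhdsGT hκ).abs.eventually_lt_const (by linarith)
  obtain ⟨δ, hδ, h⟩ := mem_nhdsGT_iff_exists_Ioo_subset.1 h1
  have hδ : 0 < δ := hδ
  refine ⟨max (|κ| + 1) (C / expWeight δ), fun u => ?_⟩
  rcases le_or_gt u 0 with hu | hu
  · rw [quotExt, if_pos hu]
    exact le_max_of_le_left (by linarith)
  · rcases lt_or_ge u δ with hu2 | hu2
    · exact le_max_of_le_left (le_of_lt (h ⟨hu, hu2⟩))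
    · refine le_max_of_le_right ?_
      rw [quotExt, if_neg (not_le.2 hu), abs_div, abs_of_pos (expWeight_pos hu)]
      exact div_le_div₀ ((abs_nonneg _).trans (hC u hu.le)) (hC u hu.le) (expWeight_pos hδ)
        (expWeight_mono hδ.le hu2)

lemma integrable_unweighted {μ : Measure ℝ} [IsFiniteMeasure μ] {g : ℝ → ℝ} {κ : ℝ}
    (hg : ContinuousOn g (Set.Ici 0)) (hb : ∃ C, ∀ u, 0 ≤ u → |g u| ≤ C)
    (hκ : Tendsto (fun u => g u / u ^ 2) (𝓝[>] 0) (𝓝 κ)) :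
    Integrable g (unweighted μ) := by
  obtain ⟨C, hC⟩ := bounded_quotExt hκ hb
  unfold unweighted
  rw [integrable_withDensity_iff measurable_ofReal_inv_expWeight (by simp)]
  have : Integrable (quotExt g κ) (μ.restrict (Set.Ioi 0)) :=
    Integrable.of_bound (continuous_quotExt hg hκ).aestronglyMeasurable C
      (Eventually.of_forall hC)
  refine this.congr ?_
  filter_upwards [ae_restrict_mem measurableSet_Ioi] with u hu
  rw [quotExt, if_neg (not_le.2 hu),
    ENNReal.toReal_ofReal (inv_nonneg.2 (expWeight_nonneg u)), div_eq_mul_inv]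

/-- Weak convergence of the weighted measures gives convergence of integrals of bounded continuous
functions of quadratic order at `0`. -/
lemma tendsto_integral_of_weighted {m : ℕ → Measure ℝ} {μ : Measure ℝ} [IsFiniteMeasure μ]
    (h0 : ∀ n, ∀ᵐ u ∂m n, 0 ≤ u)
    (hμ0 : μ (Set.Iio 0) = 0)
    (hμ : ∀ φ : ℝ → ℝ, Continuous φ → (∃ C, ∀ u, |φ u| ≤ C) →
        Tendsto (fun n => ∫ u, φ u * expWeight u ∂m n) atTop (𝓝 (∫ u, φ u ∂μ)))
    {g : ℝ → ℝ} {κ : ℝ}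
    (hg : ContinuousOn g (Set.Ici 0)) (hb : ∃ C, ∀ u, 0 ≤ u → |g u| ≤ C) (hg0 : g 0 = 0)
    (hκ : Tendsto (fun u => g u / u ^ 2) (𝓝[>] 0) (𝓝 κ)) :
    Tendsto (fun n => ∫ u, g u ∂m n) atTop
      (𝓝 (κ * μ.real {0} + ∫ u, g u ∂(unweighted μ))) := by
  have hc := continuous_quotExt hg hκ
  obtain ⟨C, hC⟩ := bounded_quotExt hκ hb
  have hi : Integrable (quotExt g κ) μ :=
    Integrable.of_bound hc.aestronglyMeasurable C (Eventually.of_forall hC)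
  have h := hμ (quotExt g κ) hc ⟨C, hC⟩
  have e : ∫ u, quotExt g κ u ∂μ = κ * μ.real {0} + ∫ u, g u ∂(unweighted μ) := by
    rw [← integral_add_compl (measurableSet_Iic (a := (0 : ℝ))) hi]
    congr 1
    · rw [setIntegral_congr_fun measurableSet_Iic (f := quotExt g κ) (g := fun _ => κ)
          (fun u hu => if_pos hu),
        setIntegral_const, smul_eq_mul, mul_comm]
      congr 1
      refine measureReal_congr ?_
      have : ∀ᵐ u ∂μ, 0 ≤ u := by
        rw [ae_iff]
        simpa [Set.Iio] using hμ0
      filter_upwards [this] with u hu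
      exact propext ⟨fun h => le_antisymm h hu, fun h => le_of_eq h⟩
    · unfold unweighted
      rw [integral_withDensity_eq_integral_toReal_smul measurable_ofReal_inv_expWeight (by simp),
        Set.compl_Iic]
      refine setIntegral_congr_fun measurableSet_Ioi fun u hu => ?_
      have hu : 0 < u := hu
      simp only [quotExt, if_neg (not_le.2 hu),
        ENNReal.toReal_ofReal (inv_nonneg.2 (expWeight_nonneg u)), div_eq_mul_inv, smul_eq_mul,
        mul_comm]
  rw [e] at h
  refine h.congr fun n => integral_congr_ae ?_
  filter_upwards [h0 n] with u hu
  rcases hu.eq_or_lt with rfl | hu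
  · simp [expWeight, hg0]
  · rw [quotExt, if_neg (not_le.2 hu), div_mul_cancel₀ _ (expWeight_pos hu).ne']

lemma integrable_compExp_of_weighted {m : ℕ → Measure ℝ} [∀ n, IsFiniteMeasure (m n)]
    {μ : Measure ℝ} [IsFiniteMeasure μ] (h0 : ∀ n, ∀ᵐ u ∂m n, 0 ≤ u)
    (hInt : ∀ n, Integrable (fun u => u) (m n)) {c : ℝ}
    (hc : Tendsto (fun n => ∫ u, compExp 1 u ∂m n) atTop (𝓝 c)) (hμ0 : μ (Set.Iio 0) = 0)
    (hμ : ∀ φ : ℝ → ℝ, Continuous φ → (∃ C, ∀ u, |φ u| ≤ C) →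
        Tendsto (fun n => ∫ u, φ u * expWeight u ∂m n) atTop (𝓝 (∫ u, φ u ∂μ))) :
    Integrable (compExp 1) (unweighted μ) := by
  let g (N : ℕ) (u : ℝ) : ℝ := min (compExp 1 u) (N + 1)
  have gnn (N : ℕ) (u : ℝ) : 0 ≤ g N u := le_min (compExp_nonneg 1 u) (by positivity)
  have gc (N : ℕ) : Continuous (g N) := (continuous_compExp 1).min continuous_const
  have gb (N : ℕ) : ∃ C, ∀ u, 0 ≤ u → |g N u| ≤ C :=
    ⟨N + 1, fun u _ => by rw [abs_of_nonneg (gnn N u)]; exact min_le_right _ _⟩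
  have g0 (N : ℕ) : g N 0 = 0 := by
    have : (0 : ℝ) ≤ N + 1 := by positivity
    simp [g, compExp, this]
  have gκ (N : ℕ) : Tendsto (fun u => g N u / u ^ 2) (𝓝[>] 0) (𝓝 (1 ^ 2 / 2)) := by
    refine (tendsto_compExp_div_sq (l := 1) zero_le_one).congr' ?_
    have h : ∀ᶠ u in 𝓝[>] 0, compExp 1 u < N + 1 := by
      have : Tendsto (compExp 1) (𝓝 0) (𝓝 (compExp 1 0)) := (continuous_compExp 1).tendsto 0
      refine (this.eventually_lt_const ?_).filter_mono nhdsWithin_le_nhds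
      simp only [compExp, mul_zero, Real.exp_zero]
      have : (0 : ℝ) ≤ N := N.cast_nonneg
      linarith
    filter_upwards [h] with u hu
    simp only [g, min_eq_left hu.le]
  have gi (N : ℕ) := integrable_unweighted (μ := μ) (gc N).continuousOn (gb N) (gκ N)
  have gle (N : ℕ) : ∫ u, g N u ∂(unweighted μ) ≤ c := by
    have h := tendsto_integral_of_weighted h0 hμ0 hμ (gc N).continuousOn (gb N) (g0 N) (gκ N)
    have h2 := le_of_tendsto_of_tendsto' h hc fun n => by
      refine integral_mono_of_nonneg (Eventually.of_forall (gnn N))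
        (integrable_compExp (h0 n) (hInt n) zero_le_one)
        (Eventually.of_forall fun u => min_le_left _ _)
    have h3 : 0 ≤ μ.real {0} := measureReal_nonneg
    linarith
  have hlim := lintegral_tendsto_of_tendsto_of_monotone (μ := unweighted μ)
    (f := fun N u => ENNReal.ofReal (g N u)) (F := fun u => ENNReal.ofReal (compExp 1 u))
    (fun N => (gc N).measurable.ennreal_ofReal.aemeasurable)
    (Eventually.of_forall fun u N M hNM => ENNReal.ofReal_le_ofReal (by
      have : (N : ℝ) ≤ M := by exact_mod_cast hNM
      exact min_le_min_left _ (by linarith)))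
    (Eventually.of_forall fun u => by
      refine tendsto_const_nhds.congr' ?_
      obtain ⟨M, hM⟩ := exists_nat_ge (compExp 1 u)
      filter_upwards [eventually_ge_atTop M] with N hN
      have : (M : ℝ) ≤ N := by exact_mod_cast hN
      simp only [g]
      rw [min_eq_left (by linarith)])
  have hle : ∫⁻ u, ENNReal.ofReal (compExp 1 u) ∂(unweighted μ) ≤ ENNReal.ofReal c := by
    refine le_of_tendsto' hlim fun N => ?_
    rw [← ofReal_integral_eq_lintegral_ofReal (gi N) (Eventually.of_forall (gnn N))]
    exact ENNReal.ofReal_le_ofReal (gle N)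
  refine ⟨(continuous_compExp 1).aestronglyMeasurable, ?_⟩
  rw [hasFiniteIntegral_iff_ofReal (Eventually.of_forall (compExp_nonneg 1))]
  exact hle.trans_lt ENNReal.ofReal_lt_top

/-- A pointwise limit of the functions `l ↦ ∫ (exp (-l u) - 1 + l u) m_n(du)` has a Lévy–Khintchine
representation, and the integrals of bounded continuous functions of quadratic order at `0`
converge. -/
theorem exists_levyKhintchine_of_tendsto {m : ℕ → Measure ℝ} [∀ n, IsFiniteMeasure (m n)]
    (h0 : ∀ n, ∀ᵐ u ∂m n, 0 ≤ u) (hInt : ∀ n, Integrable (fun u => u) (m n)) {L : ℝ → ℝ}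
    (hL : ∀ l, 0 ≤ l → Tendsto (fun n => ∫ u, compExp l u ∂m n) atTop (𝓝 (L l))) :
    ∃ (a b : ℝ) (ν : Measure ℝ), SigmaFinite ν ∧ ν (Set.Iic 0) = 0 ∧
      ν.restrict (Set.Ioi 0) = ν ∧ Integrable (compExp 1) ν ∧
      (∀ l, 0 ≤ l → L l = b * l + a * l ^ 2 + ∫ u, compExp l u ∂ν) ∧
      ∀ (g : ℝ → ℝ) (κ : ℝ), ContinuousOn g (Set.Ici 0) → (∃ C, ∀ u, 0 ≤ u → |g u| ≤ C) →
        g 0 = 0 → Tendsto (fun u => g u / u ^ 2) (𝓝[>] 0) (𝓝 κ) → Integrable g ν ∧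
        Tendsto (fun n => ∫ u, g u ∂m n) atTop (𝓝 (2 * a * κ + ∫ u, g u ∂ν)) := by
  obtain ⟨μ, hfin, hμ0, hμ⟩ := exists_weighted_limit h0 hInt hL
  have hci := integrable_compExp_of_weighted h0 hInt (hL 1 zero_le_one) hμ0 hμ
  have key : ∀ (g : ℝ → ℝ) (κ : ℝ), ContinuousOn g (Set.Ici 0) →
      (∃ C, ∀ u, 0 ≤ u → |g u| ≤ C) → g 0 = 0 →
      Tendsto (fun u => g u / u ^ 2) (𝓝[>] 0) (𝓝 κ) → Integrable g (unweighted μ) ∧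
      Tendsto (fun n => ∫ u, g u ∂m n) atTop
        (𝓝 (2 * (μ.real {0} / 2) * κ + ∫ u, g u ∂(unweighted μ))) := by
    intro g κ hg hb hg0 hκ
    refine ⟨integrable_unweighted hg hb hκ, ?_⟩
    have := tendsto_integral_of_weighted h0 hμ0 hμ hg hb hg0 hκ
    convert this using 3
    ring
  refine ⟨μ.real {0} / 2, L 1 - μ.real {0} / 2 - ∫ u, compExp 1 u ∂(unweighted μ),
    unweighted μ, sigmaFinite_unweighted μ, unweighted_Iic μ, unweighted_restrict μ, hci,
    fun l hl => ?_, key⟩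
  have hB : ∀ u, compExp l u - l * compExp 1 u
      = Real.exp (-l * u) - 1 + l * (1 - Real.exp (-u)) := by
    intro u; simp only [compExp, neg_mul, one_mul]; ring
  obtain ⟨hi, ht⟩ := key (fun u => compExp l u - l * compExp 1 u) (l ^ 2 / 2 - l * (1 ^ 2 / 2))
    ((continuous_compExp l).sub ((continuous_compExp 1).const_mul l)).continuousOn
    ⟨1 + l, fun u hu => by
      have h1 : Real.exp (-l * u) ≤ 1 := Real.exp_le_one_iff.2 (by nlinarith)
      have h2 : Real.exp (-u) ≤ 1 := Real.exp_le_one_iff.2 (by linarith)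
      have h3 := Real.exp_pos (-l * u)
      have h4 := Real.exp_pos (-u)
      have h5 : l * (1 - Real.exp (-u)) ≤ l * 1 := mul_le_mul_of_nonneg_left (by linarith) hl
      have h6 : 0 ≤ l * (1 - Real.exp (-u)) := mul_nonneg hl (by linarith)
      rw [hB, abs_le]
      constructor <;> linarith⟩
    (by simp [compExp])
    (((tendsto_compExp_div_sq hl).sub
      ((tendsto_compExp_div_sq (l := 1) zero_le_one).const_mul l)).congr fun u => by ring)
  have hlim := ht.add ((hL 1 zero_le_one).const_mul l)
  have heq : L l = _ := tendsto_nhds_unique ((hL l hl).congr fun n => by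
    have i1 := integrable_compExp (h0 n) (hInt n) hl
    have i2 := integrable_compExp (h0 n) (hInt n) zero_le_one
    rw [← integral_const_mul, ← integral_add (f := fun u => compExp l u - l * compExp 1 u)
      (i1.sub (i2.const_mul l)) (i2.const_mul l)]
    simp) hlim
  have hsum : ∫ u, compExp l u ∂(unweighted μ)
      = ∫ u, (compExp l u - l * compExp 1 u) ∂(unweighted μ)
        + l * ∫ u, compExp 1 u ∂(unweighted μ) := by
    rw [← integral_const_mul, ← integral_add hi (hci.const_mul l)]
    simp
  rw [heq, hsum]
  ring

lemma tendsto_integral_compExp_div_sq {ν : Measure ℝ} (h0 : ν (Set.Iic 0) = 0)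
    (hi : Integrable (compExp 1) ν) :
    Tendsto (fun k : ℕ => (∫ u, compExp k u ∂ν) / (k : ℝ) ^ 2) atTop (𝓝 0) := by
  have hpos : ∀ᵐ u ∂ν, 0 < u := by
    rw [ae_iff]
    convert h0 using 2
    ext u; simp
  have h := tendsto_integral_of_dominated_convergence (μ := ν)
    (F := fun (k : ℕ) u => compExp k u / (k : ℝ) ^ 2) (f := fun _ => 0)
    (fun u => 4 * compExp 1 u)
    (fun k => ((continuous_compExp k).div_const _).aestronglyMeasurable)
    (hi.const_mul 4) (fun k => by
      filter_upwards [hpos] with u hu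
      rw [Real.norm_eq_abs, abs_of_nonneg (div_nonneg (compExp_nonneg _ _) (sq_nonneg _))]
      refine le_trans ?_ (min_le_compExp u)
      rcases Nat.eq_zero_or_pos k with rfl | hk
      · simp only [Nat.cast_zero, ne_eq, OfNat.ofNat_ne_zero, not_false_eq_true, zero_pow, div_zero]
        exact le_min hu.le (sq_nonneg u)
      · have hk1 : (1 : ℝ) ≤ k := by exact_mod_cast hk
        refine le_min ?_ ?_
        · rw [div_le_iff₀ (by positivity)]
          refine (compExp_le_mul (by positivity)).trans ?_
          nlinarith [mul_pos hu (by linarith : (0 : ℝ) < k)]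
        · rw [div_le_iff₀ (by positivity), compExp_eq_one]
          exact (compExp_one_le_sq (by positivity)).trans (le_of_eq (by ring)))
    (by
      filter_upwards [hpos] with u hu
      refine squeeze_zero (fun k => div_nonneg (compExp_nonneg _ _) (sq_nonneg _)) (fun k => ?_)
        (tendsto_const_div_atTop_nhds_zero_nat u)
      rcases Nat.eq_zero_or_pos k with rfl | hk
      · simp
      · have hk1 : (0 : ℝ) < k := by exact_mod_cast hk
        calc compExp k u / (k : ℝ) ^ 2 ≤ (k * u) / (k : ℝ) ^ 2 := by
              gcongr
              exact compExp_le_mul (by positivity)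
          _ = u / k := by field_simp)
  simpa [integral_div] using h

/-- A quadratic lower bound for a Lévy–Khintchine function bounds its quadratic coefficient. -/
lemma le_of_levyKhintchine {ν : Measure ℝ} (h0 : ν (Set.Iic 0) = 0)
    (hi : Integrable (compExp 1) ν) {L : ℝ → ℝ} {a b d : ℝ}
    (hL : ∀ l, 0 ≤ l → L l = b * l + a * l ^ 2 + ∫ u, compExp l u ∂ν)
    (hd : ∀ l, 0 ≤ l → d * l ^ 2 ≤ L l) : d ≤ a := by
  have h := ((tendsto_const_div_atTop_nhds_zero_nat b).add_const a).add
    (tendsto_integral_compExp_div_sq h0 hi)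
  rw [zero_add, add_zero] at h
  refine ge_of_tendsto h ?_
  filter_upwards [eventually_gt_atTop 0] with k hk
  have hk1 : (0 : ℝ) < k := by exact_mod_cast hk
  have := hd k hk1.le
  rw [hL k hk1.le, ← le_div_iff₀ (by positivity)] at this
  refine this.trans (le_of_eq ?_)
  field_simp

lemma summable_of_tsum_eq_one {q : ℕ → ℝ} (hq : ∑' i, q i = 1) : Summable q := by
  by_contra h
  rw [tsum_eq_zero_of_not_summable h] at hq
  exact zero_ne_one hq

lemma isProbabilityMeasure_lawDiv {q : ℕ → ℝ} (hq0 : ∀ i, 0 ≤ q i) (hq1 : ∑' i, q i = 1)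
    (c : ℝ) : IsProbabilityMeasure (lawDiv q c) := by
  constructor
  rw [lawDiv, Measure.sum_apply _ MeasurableSet.univ]
  simp only [Measure.smul_apply, measure_univ, smul_eq_mul, mul_one]
  rw [← ENNReal.ofReal_tsum_of_nonneg hq0 (summable_of_tsum_eq_one hq1), hq1, ENNReal.ofReal_one]

lemma ae_nonneg_lawDiv (q : ℕ → ℝ) {c : ℝ} (hc : 0 < c) : ∀ᵐ u ∂lawDiv q c, 0 ≤ u := by
  rw [lawDiv, Measure.ae_sum_iff]
  refine fun i => Measure.ae_smul_measure ?_ _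
  rw [ae_dirac_eq]
  exact div_nonneg i.cast_nonneg hc.le

lemma hasSum_integral_lawDiv {q : ℕ → ℝ} (hq0 : ∀ i, 0 ≤ q i) {c : ℝ} {f : ℝ → ℝ}
    (hf : Integrable f (lawDiv q c)) :
    HasSum (fun i : ℕ => q i * f (i / c)) (∫ u, f u ∂lawDiv q c) := by
  refine (hasSum_integral_measure hf).congr_fun fun i => ?_
  rw [integral_smul_measure, integral_dirac, ENNReal.toReal_ofReal (hq0 i), smul_eq_mul]

lemma integrable_id_lawDiv {q : ℕ → ℝ} (hq0 : ∀ i, 0 ≤ q i)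
    (hqm : Summable fun i : ℕ => (i : ℝ) * q i) {c : ℝ} (hc : 0 < c) :
    Integrable (fun u => u) (lawDiv q c) := by
  refine ⟨measurable_id.aestronglyMeasurable, ?_⟩
  rw [hasFiniteIntegral_iff_ofReal (ae_nonneg_lawDiv q hc), lawDiv, lintegral_sum_measure]
  have h (i : ℕ) : ∫⁻ u, ENNReal.ofReal u
      ∂(ENNReal.ofReal (q i) • Measure.dirac ((i : ℝ) / c) : Measure ℝ)
      = ENNReal.ofReal ((i : ℝ) * q i / c) := by
    rw [lintegral_smul_measure, lintegral_dirac, smul_eq_mul, ← ENNReal.ofReal_mul (hq0 i)]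
    congr 1; ring
  simp_rw [h]
  rw [← ENNReal.ofReal_tsum_of_nonneg
    (fun i => div_nonneg (mul_nonneg i.cast_nonneg (hq0 i)) hc.le) (hqm.div_const c)]
  exact ENNReal.ofReal_lt_top

lemma pow_succ_sub_pow_succ_bounds {a b : ℝ} (hb : 0 ≤ b) (hab : b ≤ a) (k : ℕ) :
    (k + 1) * (a - b) * b ^ k ≤ a ^ (k + 1) - b ^ (k + 1) ∧
      a ^ (k + 1) - b ^ (k + 1) ≤ (k + 1) * (a - b) * a ^ k := by
  have ha : 0 ≤ a := hb.trans hab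
  induction k with
  | zero => simp
  | succ k ih =>
    obtain ⟨h1, h2⟩ := ih
    have hp : b ^ (k + 1) ≤ a ^ (k + 1) := pow_le_pow_left₀ hb hab _
    have e : a ^ (k + 1 + 1) - b ^ (k + 1 + 1)
        = b * (a ^ (k + 1) - b ^ (k + 1)) + (a - b) * a ^ (k + 1) := by ring
    have e' : a ^ (k + 1 + 1) - b ^ (k + 1 + 1)
        = a * (a ^ (k + 1) - b ^ (k + 1)) + (a - b) * b ^ (k + 1) := by ring
    have h1' := mul_le_mul_of_nonneg_left h1 hb
    have h2' := mul_le_mul_of_nonneg_left h2 ha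
    have h3 := mul_le_mul_of_nonneg_left hp (sub_nonneg.2 hab)
    push_cast
    constructor
    · rw [e]; ring_nf at *; linarith
    · rw [e']; ring_nf at *; linarith

lemma one_sub_pow_sub_nonneg {y : ℝ} (hy : y ≤ 2) (i : ℕ) : 0 ≤ (1 - y) ^ i - 1 + i * y := by
  have := one_add_mul_le_pow (a := -y) (by linarith) i
  rw [← sub_eq_add_neg] at this
  linarith

lemma abs_exp_pow_sub_one_sub_pow_le {x : ℝ} (h0 : 0 ≤ x) (h1 : 2 * x ≤ 1) (i : ℕ) :
    |Real.exp (-x) ^ i - (1 - x) ^ i - i * (x ^ 2 / 2)|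
      ≤ i * x ^ 3 + x * ((1 - 2 * x) ^ i - 1 + i * (2 * x)) := by
  rcases i with _ | k
  · simp
  have hd : Real.exp (-x) - (1 - x) = compExp 1 x := by simp only [compExp, neg_mul, one_mul]; ring
  have hd0 := compExp_nonneg 1 x
  have hd1 := compExp_one_le_sq h0
  obtain ⟨hd2, hd3⟩ := abs_le.1 (abs_compExp_one_sub_le h0 (by linarith))
  obtain ⟨l1, l2⟩ := pow_succ_sub_pow_succ_bounds (a := Real.exp (-x)) (b := 1 - x) (by linarith)
    (by linarith) k
  have ha : Real.exp (-x) ^ k ≤ 1 :=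
    pow_le_one₀ (Real.exp_pos _).le (Real.exp_le_one_iff.2 (by linarith))
  have hb0 : 0 ≤ (1 - x) ^ k := pow_nonneg (by linarith) _
  have hb : (1 - x) ^ k ≤ 1 := pow_le_one₀ (by linarith) (by linarith)
  have hE := one_sub_pow_sub_nonneg (y := 2 * x) (by linarith) (k + 1)
  have hE1 := one_sub_pow_sub_nonneg (y := x) (by linarith) (k + 1)
  have hE2 := (pow_succ_sub_pow_succ_bounds (a := 1 - x) (b := 1 - 2 * x) (by linarith)
    (by linarith) k).2
  rw [hd] at l1 l2
  push_cast at *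
  have hk : (0 : ℝ) ≤ k + 1 := by positivity
  set E := (1 - 2 * x) ^ (k + 1) - 1 + (k + 1) * (2 * x) with hEdef
  have hE3 : (k + 1) * x * (1 - (1 - x) ^ k) ≤ E := by
    ring_nf at *
    linarith
  have m1 : (k + 1) * compExp 1 x * (1 - (1 - x) ^ k) ≤ x * E :=
    calc (k + 1) * compExp 1 x * (1 - (1 - x) ^ k)
        ≤ (k + 1) * x ^ 2 * (1 - (1 - x) ^ k) := by
          gcongr
      _ = x * ((k + 1) * x * (1 - (1 - x) ^ k)) := by ring
      _ ≤ x * E := mul_le_mul_of_nonneg_left hE3 h0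
  have m2 : (k + 1) * compExp 1 x * Real.exp (-x) ^ k ≤ (k + 1) * compExp 1 x :=
    mul_le_of_le_one_right (mul_nonneg hk hd0) ha
  have m3 := mul_le_mul_of_nonneg_left hd2 hk
  have m4 := mul_le_mul_of_nonneg_left hd3 hk
  have m5 := mul_nonneg h0 hE
  rw [abs_le]
  constructor <;> linarith

lemma hasSum_pgf_remainder {q : ℕ → ℝ} (hq0 : ∀ i, 0 ≤ q i) (hq1 : ∑' i, q i = 1)
    (hqm : Summable fun i : ℕ => (i : ℝ) * q i) {y : ℝ} (h0 : 0 ≤ y) (h2 : y ≤ 2) :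
    HasSum (fun i : ℕ => q i * ((1 - y) ^ i - 1 + i * y)) (pgf q (1 - y) - 1 + pgfMean q * y) := by
  have hs := summable_of_tsum_eq_one hq1
  have hp : Summable fun i => q i * (1 - y) ^ i := by
    refine Summable.of_norm_bounded hs fun i => ?_
    rw [norm_mul, norm_pow, Real.norm_eq_abs, Real.norm_eq_abs, abs_of_nonneg (hq0 i)]
    exact mul_le_of_le_one_right (hq0 i)
      (pow_le_one₀ (abs_nonneg _) (abs_le.2 ⟨by linarith, by linarith⟩))
  have h1 : HasSum q 1 := hq1 ▸ hs.hasSum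
  exact ((hp.hasSum.sub h1).add (hqm.hasSum.mul_right y)).congr_fun fun i => by ring

lemma neg_Hseq_eq (q : ℕ → ℕ → ℝ) (c : ℕ → ℝ) (n : ℕ) (l : ℝ) :
    -Hseq q c n l = n * (pgf (q n) (1 - l / c n) - 1 + pgfMean (q n) * (l / c n)) := by
  simp only [Hseq]; ring

lemma neg_Hseq_nonneg {q : ℕ → ℕ → ℝ} {c : ℕ → ℝ} {n : ℕ} (hq0 : ∀ i, 0 ≤ q n i)
    (hq1 : ∑' i, q n i = 1) (hqm : Summable fun i : ℕ => (i : ℝ) * q n i) (hc : 0 < c n) {l : ℝ}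
    (hl : 0 ≤ l) (hlc : l / c n ≤ 2) : 0 ≤ -Hseq q c n l := by
  rw [neg_Hseq_eq]
  refine mul_nonneg n.cast_nonneg
    ((hasSum_pgf_remainder hq0 hq1 hqm (by positivity) hlc).nonneg fun i => ?_)
  exact mul_nonneg (hq0 i) (one_sub_pow_sub_nonneg hlc i)

lemma abs_integral_compExp_lawDiv_le {q : ℕ → ℕ → ℝ} {c : ℕ → ℝ} {n : ℕ} (hq0 : ∀ i, 0 ≤ q n i)
    (hq1 : ∑' i, q n i = 1) (hqm : Summable fun i : ℕ => (i : ℝ) * q n i) (hc : 0 < c n) {l : ℝ}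
    (hl : 0 ≤ l) (hlc : 2 * (l / c n) ≤ 1) :
    |n * ∫ u, compExp l u ∂lawDiv (q n) (c n) - -Hseq q c n l
        - n * (pgfMean (q n) * ((l / c n) ^ 2 / 2))|
      ≤ n * (pgfMean (q n) * (l / c n) ^ 3) + l / c n * -Hseq q c n (2 * l) := by
  have hx : 0 ≤ l / c n := by positivity
  have := isProbabilityMeasure_lawDiv hq0 hq1 (c n)
  have hi := hasSum_integral_lawDiv hq0 (integrable_compExp (ae_nonneg_lawDiv (q n) hc)
    (integrable_id_lawDiv hq0 hqm hc) hl)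
  have hr := hasSum_pgf_remainder hq0 hq1 hqm hx (by linarith)
  have hr2 := hasSum_pgf_remainder hq0 hq1 hqm (y := 2 * (l / c n)) (by linarith) (by linarith)
  have hd := (hi.sub hr).sub (hqm.hasSum.mul_right ((l / c n) ^ 2 / 2))
  have hb := (hqm.hasSum.mul_right ((l / c n) ^ 3)).add (hr2.mul_left (l / c n))
  have key := hd.norm_le_of_bounded hb fun i => by
    have he : compExp l (i / c n)
        = Real.exp (-(l / c n)) ^ i - 1 + i * (l / c n) := by
      rw [compExp, ← Real.exp_nat_mul, show -l * (i / c n) = i * -(l / c n) by ring]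
      ring
    have hm := mul_le_mul_of_nonneg_left (abs_exp_pow_sub_one_sub_pow_le hx hlc i) (hq0 i)
    rw [← abs_of_nonneg (hq0 i), ← abs_mul, abs_of_nonneg (hq0 i)] at hm
    rw [Real.norm_eq_abs, he]
    refine (le_of_eq ?_).trans (hm.trans (le_of_eq ?_))
    · congr 1; ring
    · ring
  have hm := mul_le_mul_of_nonneg_left key n.cast_nonneg
  rw [neg_Hseq_eq, neg_Hseq_eq, mul_div_assoc]
  change _ * |_ - _ - pgfMean (q n) * _| ≤ _ * (pgfMean (q n) * _ + _) at hm
  rw [← abs_of_nonneg (n.cast_nonneg : (0 : ℝ) ≤ n), ← abs_mul,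
    abs_of_nonneg (n.cast_nonneg : (0 : ℝ) ≤ n)] at hm
  refine (le_of_eq ?_).trans (hm.trans (le_of_eq ?_))
  · congr 1; ring
  · ring

lemma compExp_one_mean_le_integral_lawDiv {q : ℕ → ℝ} (hq0 : ∀ i, 0 ≤ q i)
    (hq1 : ∑' i, q i = 1) (hqm : Summable fun i : ℕ => (i : ℝ) * q i) {c : ℝ} (hc : 0 < c) {l : ℝ}
    (hl : 0 ≤ l) :
    compExp 1 (pgfMean q * (l / c)) ≤ ∫ u, compExp l u ∂lawDiv q c := by
  have := isProbabilityMeasure_lawDiv hq0 hq1 c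
  have hi := hasSum_integral_lawDiv hq0 (integrable_compExp (ae_nonneg_lawDiv q hc)
    (integrable_id_lawDiv hq0 hqm hc) hl)
  have h1 : HasSum q 1 := hq1 ▸ (summable_of_tsum_eq_one hq1).hasSum
  set m := pgfMean q * (l / c) with hm
  have hs := (h1.mul_right (compExp 1 m - (1 - Real.exp (-m)) * m)).add
    (hqm.hasSum.mul_right ((1 - Real.exp (-m)) * (l / c)))
  have hle := hasSum_le (fun i => ?_) hs hi
  · change _ + pgfMean q * _ ≤ _ at hle
    refine le_trans (le_of_eq ?_) hle
    rw [hm]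
    ring
  · have ht : Real.exp (-m) * (1 - (i * (l / c) - m)) ≤ Real.exp (-l * (i / c)) :=
      calc Real.exp (-m) * (1 - (i * (l / c) - m))
          ≤ Real.exp (-m) * Real.exp (-(i * (l / c) - m)) := by
            gcongr
            exact Real.one_sub_le_exp_neg _
        _ = Real.exp (-l * (i / c)) := by
            rw [← Real.exp_add]
            congr 1; ring
    have := mul_le_mul_of_nonneg_left ht (hq0 i)
    simp only [compExp, neg_mul, one_mul] at *
    ring_nf at *
    linarith

section

variable {q : ℕ → ℕ → ℝ} {c : ℕ → ℝ} {γ₀ ω : ℝ}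

lemma tendsto_div_of_scaling (hC1 : Tendsto (fun n : ℕ => (n : ℝ) / c n) atTop atTop)
    (hC2 : Tendsto (fun n : ℕ => (n : ℝ) / c n ^ 2) atTop (𝓝 γ₀)) (l : ℝ) :
    Tendsto (fun n => l / c n) atTop (𝓝 0) := by
  have h := (hC2.div_atTop hC1).const_mul l
  rw [mul_zero] at h
  refine h.congr' ?_
  filter_upwards [hC1.eventually_gt_atTop 0] with n hn
  have h1 : c n ≠ 0 := fun h => by simp [h] at hn
  have h2 : (n : ℝ) ≠ 0 := fun h => by simp [h] at hn
  field_simp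

lemma tendsto_mul_sq_of_scaling
    (hC2 : Tendsto (fun n : ℕ => (n : ℝ) / c n ^ 2) atTop (𝓝 γ₀)) (l : ℝ) :
    Tendsto (fun n : ℕ => (n : ℝ) * (l / c n) ^ 2) atTop (𝓝 (γ₀ * l ^ 2)) :=
  (hC2.mul_const (l ^ 2)).congr fun n => by ring

lemma tendsto_integral_compExp_lawDiv
    (hq0 : ∀ n i, 0 ≤ q n i) (hq1 : ∀ n, ∑' i, q n i = 1)
    (hqm : ∀ n, Summable fun i : ℕ => (i : ℝ) * q n i) (hcpos : ∀ n, 0 < c n)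
    (hC1 : Tendsto (fun n : ℕ => (n : ℝ) / c n) atTop atTop)
    (hC2 : Tendsto (fun n : ℕ => (n : ℝ) / c n ^ 2) atTop (𝓝 γ₀))
    (hE1 : Tendsto (fun n : ℕ => pgfMean (q n)) atTop (𝓝 ω)) {H : ℝ → ℝ}
    (hHlim : ∀ l : ℝ, 0 ≤ l → Tendsto (fun n => Hseq q c n l) atTop (𝓝 (H l))) {l : ℝ}
    (hl : 0 ≤ l) :
    Tendsto (fun n : ℕ => (n : ℝ) * ∫ u, compExp l u ∂lawDiv (q n) (c n)) atTop
      (𝓝 (-H l + ω * (γ₀ * l ^ 2 / 2))) := by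
  have hx := tendsto_div_of_scaling hC1 hC2 l
  have hx2 := tendsto_mul_sq_of_scaling hC2 l
  have hmain : Tendsto (fun n : ℕ => (n : ℝ) * (pgfMean (q n) * ((l / c n) ^ 2 / 2))) atTop
      (𝓝 (ω * (γ₀ * l ^ 2 / 2))) :=
    (hE1.mul (hx2.div_const 2)).congr fun n => by ring
  have hbound : Tendsto (fun n : ℕ => (n : ℝ) * (pgfMean (q n) * (l / c n) ^ 3)
      + l / c n * -Hseq q c n (2 * l)) atTop (𝓝 0) := by
    have := ((hE1.mul hx2).mul hx).add (hx.mul (hHlim (2 * l) (by positivity)).neg)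
    rw [mul_zero, zero_mul, add_zero] at this
    exact this.congr fun n => by ring
  have herr := squeeze_zero_norm' (a := fun n : ℕ => (n : ℝ) * (pgfMean (q n) * (l / c n) ^ 3)
      + l / c n * -Hseq q c n (2 * l)) (f := fun n : ℕ =>
      (n : ℝ) * ∫ u, compExp l u ∂lawDiv (q n) (c n) - -Hseq q c n l
        - n * (pgfMean (q n) * ((l / c n) ^ 2 / 2))) (by
    filter_upwards [hx.eventually_lt_const (by norm_num : (0 : ℝ) < 1 / 2)] with n hn
    exact abs_integral_compExp_lawDiv_le (hq0 n) (hq1 n) (hqm n) (hcpos n) hl (by linarith)) hbound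
  have := herr.add ((hHlim l hl).neg.add hmain)
  rw [zero_add] at this
  exact this.congr fun n => by ring

lemma nonpos_of_tendsto_Hseq
    (hq0 : ∀ n i, 0 ≤ q n i) (hq1 : ∀ n, ∑' i, q n i = 1)
    (hqm : ∀ n, Summable fun i : ℕ => (i : ℝ) * q n i) (hcpos : ∀ n, 0 < c n)
    (hC1 : Tendsto (fun n : ℕ => (n : ℝ) / c n) atTop atTop)
    (hC2 : Tendsto (fun n : ℕ => (n : ℝ) / c n ^ 2) atTop (𝓝 γ₀)) {l h : ℝ}
    (hl : 0 ≤ l) (hlim : Tendsto (fun n => Hseq q c n l) atTop (𝓝 h)) : h ≤ 0 := by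
  refine le_of_tendsto hlim ?_
  filter_upwards [(tendsto_div_of_scaling hC1 hC2 l).eventually_lt_const (zero_lt_two' ℝ)]
    with n hn
  exact neg_nonneg.1 (neg_Hseq_nonneg (hq0 n) (hq1 n) (hqm n) (hcpos n) hl hn.le)

lemma sq_mean_le_of_tendsto
    (hq0 : ∀ n i, 0 ≤ q n i) (hq1 : ∀ n, ∑' i, q n i = 1)
    (hqm : ∀ n, Summable fun i : ℕ => (i : ℝ) * q n i) (hcpos : ∀ n, 0 < c n)
    (hC1 : Tendsto (fun n : ℕ => (n : ℝ) / c n) atTop atTop)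
    (hC2 : Tendsto (fun n : ℕ => (n : ℝ) / c n ^ 2) atTop (𝓝 γ₀))
    (hE1 : Tendsto (fun n : ℕ => pgfMean (q n)) atTop (𝓝 ω)) {l h : ℝ} (hl : 0 ≤ l)
    (hlim : Tendsto (fun n : ℕ => (n : ℝ) * ∫ u, compExp l u ∂lawDiv (q n) (c n)) atTop (𝓝 h)) :
    ω ^ 2 * (γ₀ * l ^ 2 / 2) ≤ h := by
  have hx := tendsto_div_of_scaling hC1 hC2 l
  have hx2 := tendsto_mul_sq_of_scaling hC2 l
  have hy := hE1.mul hx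
  rw [mul_zero] at hy
  have hlow := ((hE1.pow 2).mul (hx2.div_const 2)).sub (((hE1.pow 2).mul hx2).mul hy)
  rw [mul_zero, sub_zero] at hlow
  refine le_of_tendsto_of_tendsto hlow hlim ?_
  filter_upwards [hy.eventually_lt_const one_pos] with n hn
  have h0 : 0 ≤ pgfMean (q n) * (l / c n) :=
    mul_nonneg (tsum_nonneg fun i => mul_nonneg i.cast_nonneg (hq0 n i))
      (div_nonneg hl (hcpos n).le)
  have h1 := (abs_le.1 (abs_compExp_one_sub_le h0 hn.le)).1
  have h2 := compExp_one_mean_le_integral_lawDiv (hq0 n) (hq1 n) (hqm n) (hcpos n) hl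
  refine le_trans (le_of_eq ?_) (mul_le_mul_of_nonneg_left (
    (by linarith : (pgfMean (q n) * (l / c n)) ^ 2 / 2 - (pgfMean (q n) * (l / c n)) ^ 3
      ≤ ∫ u, compExp l u ∂lawDiv (q n) (c n))) (n.cast_nonneg : (0 : ℝ) ≤ n))
  ring

end

lemma continuous_chi : Continuous chi := by unfold chi; fun_prop

lemma abs_chi_le_one (u : ℝ) : |chi u| ≤ 1 :=
  abs_le.2 ⟨le_max_right _ _, max_le (min_le_left _ _) (by norm_num)⟩

lemma chi_of_mem_Icc {u : ℝ} (h0 : 0 ≤ u) (h1 : u ≤ 1) : chi u = u := by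
  rw [chi, min_eq_right h1, max_eq_left (by linarith)]

lemma tendsto_chi_sq_div_sq : Tendsto (fun u => chi u ^ 2 / u ^ 2) (𝓝[>] 0) (𝓝 1) := by
  refine tendsto_const_nhds.congr' ?_
  filter_upwards [Ioo_mem_nhdsGT (zero_lt_one' ℝ)] with u hu
  have : u ≠ 0 := hu.1.ne'
  rw [chi_of_mem_Icc hu.1.le hu.2.le, div_self (by positivity)]

lemma tendsto_chi_sub_add_compExp_div_sq :
    Tendsto (fun u => (chi u - u + compExp 1 u) / u ^ 2) (𝓝[>] 0) (𝓝 (1 / 2)) := by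
  have h := tendsto_compExp_div_sq (l := 1) zero_le_one
  rw [one_pow] at h
  refine h.congr' ?_
  filter_upwards [Ioo_mem_nhdsGT (zero_lt_one' ℝ)] with u hu
  rw [chi_of_mem_Icc hu.1.le hu.2.le, sub_self, zero_add]

lemma abs_chi_sub_add_compExp_le {u : ℝ} (hu : 0 ≤ u) : |chi u - u + compExp 1 u| ≤ 2 := by
  have h := abs_le.1 (abs_chi_le_one u)
  have h1 : Real.exp (-u) ≤ 1 := Real.exp_le_one_iff.2 (by linarith)
  have h2 := Real.exp_pos (-u)
  simp only [compExp, neg_mul, one_mul]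
  rw [abs_le]
  constructor <;> linarith [h.1, h.2]

end

theorem stmt4
    (q : ℕ → ℕ → ℝ)
    (hq0 : ∀ n i, 0 ≤ q n i) (hq1 : ∀ n, ∑' i, q n i = 1)
    -- the immigration means `ω_n` are finite
    (hqm : ∀ n, Summable fun i : ℕ => (i : ℝ) * q n i)
    (c : ℕ → ℝ) (hcpos : ∀ n, 0 < c n)
    (γ₀ ω : ℝ) (hγ₀ : 0 ≤ γ₀) (hω : 0 ≤ ω)
    -- condition (C)
    (hC1 : Tendsto (fun n : ℕ => (n : ℝ) / c n) atTop atTop)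
    (hC2 : Tendsto (fun n : ℕ => (n : ℝ) / c n ^ 2) atTop (𝓝 γ₀))
    -- condition (E1)
    (hE1 : Tendsto (fun n : ℕ => pgfMean (q n)) atTop (𝓝 ω))
    -- condition (E2)
    (H : ℝ → ℝ)
    (hHlip : ∀ M > (0 : ℝ), ∃ K : ℝ, ∀ (n : ℕ) (l l' : ℝ),
      l ∈ Set.Icc 0 M → l' ∈ Set.Icc 0 M → l ≤ c n → l' ≤ c n →
      |Hseq q c n l - Hseq q c n l'| ≤ K * |l - l'|)
    (hHlim : ∀ l : ℝ, 0 ≤ l → Tendsto (fun n => Hseq q c n l) atTop (𝓝 (H l)))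
    (hHcont : ContinuousOn H (Set.Ici 0)) :
    ∃ (β₂ σ₂ : ℝ) (ν : Measure ℝ), 0 ≤ σ₂ ∧ ω ^ 2 * γ₀ ≤ 2 * σ₂ + ω * γ₀ ∧
      SigmaFinite ν ∧ ν (Set.Iic 0) = 0 ∧
      (∫⁻ u in Set.Ioi (0 : ℝ), ENNReal.ofReal (min u (u ^ 2)) ∂ν) < ⊤ ∧
      (∀ l : ℝ, 0 ≤ l →
        H l = β₂ * l - σ₂ * l ^ 2
          - ∫ u in Set.Ioi (0 : ℝ), (Real.exp (-l * u) - 1 + l * u) ∂ν) ∧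
      -- (i)
      Tendsto (fun n : ℕ => (n : ℝ) * ∫ u, (chi u - u) ∂(lawDiv (q n) (c n)))
        atTop (𝓝 (β₂ - ∫ u in Set.Ioi (0 : ℝ), (u - chi u) ∂ν)) ∧
      -- (ii)
      Tendsto (fun n : ℕ => (n : ℝ) * ∫ u, chi u ^ 2 ∂(lawDiv (q n) (c n)))
        atTop (𝓝 (2 * σ₂ + ω * γ₀ + ∫ u in Set.Ioi (0 : ℝ), chi u ^ 2 ∂ν)) ∧
      -- (iii)
      (∀ f : ℝ → ℝ, ContinuousOn f (Set.Ici 0) → (∃ C, ∀ x : ℝ, 0 ≤ x → |f x| ≤ C) →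
        f =o[nhdsWithin 0 (Set.Ici 0)] (fun x => x ^ 2) →
        Tendsto (fun n : ℕ => (n : ℝ) * ∫ u, f u ∂(lawDiv (q n) (c n)))
          atTop (𝓝 (∫ u in Set.Ioi (0 : ℝ), f u ∂ν))) := by
  have hfin (n : ℕ) := isProbabilityMeasure_lawDiv (hq0 n) (hq1 n) (c n)
  have hnn (n : ℕ) := ae_nonneg_lawDiv (q n) (hcpos n)
  have hid (n : ℕ) := integrable_id_lawDiv (hq0 n) (hqm n) (hcpos n)
  let m (n : ℕ) : Measure ℝ := (n : NNReal) • lawDiv (q n) (c n)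
  have hm (n : ℕ) (f : ℝ → ℝ) : ∫ u, f u ∂m n = n * ∫ u, f u ∂lawDiv (q n) (c n) := by
    rw [integral_smul_nnreal_measure]
    simp [NNReal.smul_def]
  have hInt (n : ℕ) : Integrable (fun u => u) (m n) := (hid n).smul_measure_nnreal
  have hnn' (n : ℕ) : ∀ᵐ u ∂m n, 0 ≤ u := Measure.ae_smul_measure (hnn n) _
  let L (l : ℝ) : ℝ := -H l + ω * (γ₀ * l ^ 2 / 2)
  have hL (l : ℝ) (hl : 0 ≤ l) : Tendsto (fun n => ∫ u, compExp l u ∂m n) atTop (𝓝 (L l)) := by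
    simp only [hm]
    exact tendsto_integral_compExp_lawDiv hq0 hq1 hqm hcpos hC1 hC2 hE1 hHlim hl
  obtain ⟨a, b, ν, hσ, hν0, hνr, hνi, hrep, hconv⟩ := exists_levyKhintchine_of_tendsto hnn' hInt hL
  have ha1 : ω * γ₀ / 2 ≤ a := le_of_levyKhintchine hν0 hνi hrep fun l hl => by
    have := nonpos_of_tendsto_Hseq hq0 hq1 hqm hcpos hC1 hC2 hl (hHlim l hl)
    simp only [L]
    linarith
  have ha2 : ω ^ 2 * γ₀ / 2 ≤ a := le_of_levyKhintchine hν0 hνi hrep fun l hl => by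
    have := sq_mean_le_of_tendsto hq0 hq1 hqm hcpos hC1 hC2 hE1 hl
      (tendsto_integral_compExp_lawDiv hq0 hq1 hqm hcpos hC1 hC2 hE1 hHlim hl)
    simp only [L]
    linarith
  simp only [hm] at hconv
  refine ⟨-b, a - ω * γ₀ / 2, ν, by linarith, by linarith, hσ, hν0, ?_, ?_, ?_, ?_, ?_⟩
  · rw [hνr]
    refine lt_of_le_of_lt (lintegral_mono fun u => ENNReal.ofReal_le_ofReal (min_le_compExp u)) ?_
    rw [← hasFiniteIntegral_iff_ofReal
      (Eventually.of_forall fun u => mul_nonneg (by norm_num) (compExp_nonneg 1 u))]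
    exact (hνi.const_mul 4).2
  · intro l hl
    rw [hνr]
    have := hrep l hl
    change -H l + ω * (γ₀ * l ^ 2 / 2) = b * l + a * l ^ 2
      + ∫ u, (Real.exp (-l * u) - 1 + l * u) ∂ν at this
    linarith
  · rw [hνr]
    obtain ⟨hi, ht⟩ := hconv (fun u => chi u - u + compExp 1 u) (1 / 2)
      ((continuous_chi.sub continuous_id).add (continuous_compExp 1)).continuousOn
      ⟨2, fun u hu => abs_chi_sub_add_compExp_le hu⟩ (by simp [chi, compExp])
      tendsto_chi_sub_add_compExp_div_sq
    have hL1 := hL 1 zero_le_one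
    simp only [hm] at hL1
    have hν : ∫ u, (u - chi u) ∂ν
        = ∫ u, compExp 1 u ∂ν - ∫ u, (chi u - u + compExp 1 u) ∂ν := by
      rw [← integral_sub hνi hi]
      congr 1; ext u; ring
    have hlim : -b - ∫ u, (u - chi u) ∂ν
        = 2 * a * (1 / 2) + ∫ u, (chi u - u + compExp 1 u) ∂ν - L 1 := by
      rw [hrep 1 zero_le_one, hν]
      ring
    rw [hlim]
    refine (ht.sub hL1).congr fun n => ?_
    have hc := integrable_compExp (hnn n) (hid n) zero_le_one
    have hχ : Integrable chi (lawDiv (q n) (c n)) :=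
      .of_bound continuous_chi.aestronglyMeasurable 1 (Eventually.of_forall abs_chi_le_one)
    have hs : Integrable (fun u => chi u - u) (lawDiv (q n) (c n)) := hχ.sub (hid n)
    rw [integral_add hs hc]
    ring
  · rw [hνr]
    convert (hconv (fun u => chi u ^ 2) 1 (continuous_chi.pow 2).continuousOn
      ⟨1, fun u _ => by
        rw [abs_of_nonneg (sq_nonneg _), sq_le_one_iff_abs_le_one]
        exact abs_chi_le_one u⟩ (by simp [chi]) tendsto_chi_sq_div_sq).2 using 3
    ring
  · intro f hf hb ho
    rw [hνr]
    have hf0 : f 0 = 0 := by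
      obtain ⟨K, hK⟩ := ho.isBigO.bound
      simpa using hK.self_of_nhdsWithin Set.self_mem_Ici
    have := (hconv f 0 hf hb hf0 (ho.tendsto_div_nhds_zero.mono_left
      (nhdsWithin_mono 0 Set.Ioi_subset_Ici_self))).2
    rwa [mul_zero, zero_add] at this
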